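/- Let S_k and S_ℓ be subspaces of ℝ^m of dimensions d_k and d_ℓ with orthonormal bases U^{(k)} ∈ ℝ^{m×d_k} and U^{(ℓ)} ∈ ℝ^{m×d_ℓ}, and let Φ ∈ ℝ^{p×m} be a matrix such that for some δ < 1 both ‖(U^{(ℓ)})ᵀ(ΦᵀΦ − I)U^{(ℓ)}‖_{2→2} ≤ δ and ‖(U^{(ℓ)})ᵀ(ΦᵀΦ − I)U^{(k)}‖_{2→2} ≤ δ hold. Set V^{(k)} = ΦU^{(k)}, V^{(ℓ)} = ΦU^{(ℓ)}. Then V^{(ℓ)} has full column rank and (1/√(d_k)) ‖(V^{(ℓ)})† V^{(k)}‖_F ≤ (1/(1 − δ)) (aff(S_k, S_ℓ) + δ), where (V^{(ℓ)})† = ((V^{(ℓ)})ᵀ V^{(ℓ)})^{−1}(V^{(ℓ)})ᵀ. -/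

import Mathlib

open MeasureTheory ProbabilityTheory Matrix Finset

/-- Frobenius norm of a real matrix. -/
noncomputable def frobNorm {α β : Type*} [Fintype α] [Fintype β] (A : Matrix α β ℝ) : ℝ :=
  Real.sqrt (∑ i, ∑ j, A i j ^ 2)

/-- Spectral norm (operator norm w.r.t. Euclidean norms) of a real matrix. -/
noncomputable def specNorm {α β : Type*} [Fintype α] [Fintype β] [DecidableEq β]
    (A : Matrix α β ℝ) : ℝ :=
  ‖LinearMap.toContinuousLinearMap (Matrix.toEuclideanLin A)‖

/-- A random matrix `Φ : Ω → ℝ^{p×m}` satisfies the Johnson–Lindenstrauss property with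
constant `ct > 0` if `P[ |‖Φx‖² - ‖x‖²| ≥ t‖x‖² ] ≤ 2 exp(-ct t² p)` for all `x` and `t > 0`. -/
def HasJLProperty {Ω : Type*} [MeasurableSpace Ω] (μ : Measure Ω) {p m : ℕ}
    (Φ : Ω → Matrix (Fin p) (Fin m) ℝ) (ct : ℝ) : Prop :=
  ∀ (x : Fin m → ℝ), ∀ t > (0:ℝ),
    (μ {ω | t * ∑ i, x i ^ 2 ≤ |(∑ i, ((Φ ω).mulVec x i) ^ 2) - ∑ i, x i ^ 2|}).toReal
      ≤ 2 * Real.exp (-(ct * t ^ 2 * p))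

/-- A random vector `a : Ω → ℝ^d` is uniformly distributed on the unit sphere of `ℝ^d`:
it is measurable, a.s. of unit norm, and its law is invariant under orthogonal transformations
(these properties uniquely characterize the uniform distribution on the sphere). -/
def UnifOnSphere {Ω : Type*} [MeasurableSpace Ω] (μ : Measure Ω) {d : ℕ}
    (a : Ω → Fin d → ℝ) : Prop :=
  Measurable a ∧ (∀ᵐ ω ∂μ, ∑ r, a ω r ^ 2 = 1) ∧
    ∀ R : Matrix (Fin d) (Fin d) ℝ, Rᵀ * R = 1 →
      μ.map (fun ω => R.mulVec (a ω)) = μ.map a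

/-- `U` is a matrix whose columns form an orthonormal basis of the subspace `S ⊆ ℝ^m`. -/
def IsONBasis {m d : ℕ} (U : Matrix (Fin m) (Fin d) ℝ)
    (S : Submodule ℝ (Fin m → ℝ)) : Prop :=
  Uᵀ * U = 1 ∧ S = Submodule.span ℝ (Set.range Uᵀ)

/-- The `k`-th order statistic (1-indexed, `k`-th smallest element) of a multiset of reals. -/
noncomputable def orderStat (s : Multiset ℝ) (k : ℕ) : ℝ :=
  (s.sort (· ≤ ·)).getD (k - 1) 0

theorem frobNorm_sq {α β : Type*} [Fintype α] [Fintype β] (A : Matrix α β ℝ) :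
    frobNorm A ^ 2 = ∑ i, ∑ j, A i j ^ 2 :=
  Real.sq_sqrt (by positivity)

theorem frobNorm_nonneg {α β : Type*} [Fintype α] [Fintype β] (A : Matrix α β ℝ) :
    0 ≤ frobNorm A :=
  Real.sqrt_nonneg _

theorem frobNorm_transpose {α β : Type*} [Fintype α] [Fintype β] (A : Matrix α β ℝ) :
    frobNorm Aᵀ = frobNorm A :=
  congrArg Real.sqrt Finset.sum_comm

theorem frobNorm_sq_eq_sum_norm_col {α β : Type*} [Fintype α] [Fintype β] (A : Matrix α β ℝ) :
    frobNorm A ^ 2 = ∑ j, ‖WithLp.toLp 2 (A.col j)‖ ^ 2 := by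
  rw [frobNorm_sq, Finset.sum_comm]
  simp [EuclideanSpace.norm_sq_eq]

open scoped Matrix.Norms.Frobenius in
theorem frobNorm_add_le {α β : Type*} [Fintype α] [Fintype β] (A B : Matrix α β ℝ) :
    frobNorm (A + B) ≤ frobNorm A + frobNorm B := by
  have h (M : Matrix α β ℝ) : frobNorm M = ‖M‖ := by
    simp [frobNorm, Matrix.frobenius_norm_def, Real.sqrt_eq_rpow]
  simpa only [h] using norm_add_le A B

theorem specNorm_nonneg {α β : Type*} [Fintype α] [Fintype β] [DecidableEq β]
    (A : Matrix α β ℝ) : 0 ≤ specNorm A :=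
  norm_nonneg _

theorem norm_mulVec_le_specNorm {α β : Type*} [Fintype α] [Fintype β] [DecidableEq β]
    (A : Matrix α β ℝ) (v : β → ℝ) :
    ‖WithLp.toLp 2 (A *ᵥ v)‖ ≤ specNorm A * ‖WithLp.toLp 2 v‖ :=
  (LinearMap.toContinuousLinearMap (Matrix.toEuclideanLin A)).le_opNorm (WithLp.toLp 2 v)

theorem frobNorm_le_sqrt_card_mul_specNorm {α β : Type*} [Fintype α] [Fintype β] [DecidableEq β]
    (A : Matrix α β ℝ) : frobNorm A ≤ √(Fintype.card β) * specNorm A := by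
  refine le_of_pow_le_pow_left₀ two_ne_zero
    (mul_nonneg (Real.sqrt_nonneg _) (specNorm_nonneg A)) ?_
  rw [frobNorm_sq_eq_sum_norm_col, mul_pow, Real.sq_sqrt (Nat.cast_nonneg _), ← nsmul_eq_mul]
  refine Finset.sum_le_card_nsmul _ _ _ fun j _ => ?_
  have h := norm_mulVec_le_specNorm A (Pi.single j 1)
  rw [mulVec_single_one, PiLp.toLp_single, PiLp.norm_single, norm_one, mul_one] at h
  gcongr

theorem le_norm_mulVec_of_specNorm_sub_one_le {α : Type*} [Fintype α] [DecidableEq α]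
    {A : Matrix α α ℝ} {δ : ℝ} (h : specNorm (A - 1) ≤ δ) (v : α → ℝ) :
    (1 - δ) * ‖WithLp.toLp 2 v‖ ≤ ‖WithLp.toLp 2 (A *ᵥ v)‖ := by
  have h₁ := norm_mulVec_le_specNorm (A - 1) v
  rw [sub_mulVec, one_mulVec, WithLp.toLp_sub] at h₁
  have h₂ := mul_le_mul_of_nonneg_right h (norm_nonneg (WithLp.toLp 2 v))
  have h₃ := norm_sub_norm_le (WithLp.toLp 2 v) (WithLp.toLp 2 (A *ᵥ v))
  rw [norm_sub_rev] at h₃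
  linarith

theorem isUnit_of_specNorm_sub_one_le {α : Type*} [Fintype α] [DecidableEq α]
    {A : Matrix α α ℝ} {δ : ℝ} (hδ : δ < 1) (h : specNorm (A - 1) ≤ δ) : IsUnit A := by
  rw [← mulVec_injective_iff_isUnit]
  refine (injective_iff_map_eq_zero A.mulVecLin).2 fun v hv => ?_
  have h₁ := le_norm_mulVec_of_specNorm_sub_one_le h v
  rw [← mulVecLin_apply, hv, WithLp.toLp_zero, norm_zero] at h₁
  have h₂ : ‖WithLp.toLp 2 v‖ = 0 :=
    le_antisymm (nonpos_of_mul_nonpos_right h₁ (sub_pos.2 hδ)) (norm_nonneg _)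
  simpa using h₂

theorem le_frobNorm_mul_of_specNorm_sub_one_le {α β : Type*} [Fintype α] [DecidableEq α]
    [Fintype β] {A : Matrix α α ℝ} {δ : ℝ} (hδ : δ < 1) (h : specNorm (A - 1) ≤ δ)
    (X : Matrix α β ℝ) : (1 - δ) * frobNorm X ≤ frobNorm (A * X) := by
  refine le_of_pow_le_pow_left₀ two_ne_zero (frobNorm_nonneg _) ?_
  rw [mul_pow, frobNorm_sq_eq_sum_norm_col, frobNorm_sq_eq_sum_norm_col, Finset.mul_sum]
  refine Finset.sum_le_sum fun j _ => ?_
  rw [← mul_pow]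
  exact pow_le_pow_left₀ (mul_nonneg (sub_pos.2 hδ).le (norm_nonneg _))
    (le_norm_mulVec_of_specNorm_sub_one_le h (X.col j)) 2

/-- With orthonormal bases `Uk, Ul` of `S_k, S_ℓ` (where `d_k ≤ d_ℓ`) and
spectral-norm perturbation bounds `≤ δ < 1`, the matrix `Vl = ΦUl` has full column rank and
`(1/√dk)‖Vl† Vk‖_F ≤ (1/(1−δ))(aff(S_k,S_ℓ) + δ)`, where `Vl† = (VlᵀVl)⁻¹Vlᵀ`. -/
theorem stmt6 {m p dk dl : ℕ} (hdkdl : dk ≤ dl)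
    (Uk : Matrix (Fin m) (Fin dk) ℝ) (Ul : Matrix (Fin m) (Fin dl) ℝ)
    (hUk : Ukᵀ * Uk = 1) (hUl : Ulᵀ * Ul = 1)
    (Φ : Matrix (Fin p) (Fin m) ℝ) (δ : ℝ) (hδ : δ < 1)
    (h1 : specNorm (Ulᵀ * (Φᵀ * Φ - 1) * Ul) ≤ δ)
    (h2 : specNorm (Ulᵀ * (Φᵀ * Φ - 1) * Uk) ≤ δ) :
    (Φ * Ul).rank = dl ∧
      frobNorm ((((Φ * Ul)ᵀ * (Φ * Ul))⁻¹ * (Φ * Ul)ᵀ) * (Φ * Uk)) / Real.sqrt (dk : ℝ) ≤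
        (1 / (1 - δ)) *
          (frobNorm (Ukᵀ * Ul) / Real.sqrt (min (dk : ℝ) (dl : ℝ)) + δ) := by
  set A := (Φ * Ul)ᵀ * (Φ * Ul) with hA
  have hA₁ : specNorm (A - 1) ≤ δ := by
    convert h1 using 2
    rw [hA, Matrix.mul_sub, Matrix.sub_mul, Matrix.mul_one, hUl, transpose_mul]
    simp only [Matrix.mul_assoc]
  have hAu : IsUnit A := isUnit_of_specNorm_sub_one_le hδ hA₁
  refine ⟨by rw [← rank_transpose_mul_self, rank_of_isUnit _ hAu, Fintype.card_fin], ?_⟩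
  have hB : A * (A⁻¹ * (Φ * Ul)ᵀ * (Φ * Uk)) =
      (Ukᵀ * Ul)ᵀ + Ulᵀ * (Φᵀ * Φ - 1) * Uk := by
    rw [Matrix.mul_assoc A⁻¹, mul_nonsing_inv_cancel_left _ _ ((isUnit_iff_isUnit_det A).1 hAu),
      Matrix.mul_sub, Matrix.sub_mul, Matrix.mul_one, transpose_mul, transpose_mul, transpose_transpose,
      add_sub_cancel]
    simp only [Matrix.mul_assoc]
  have hX := le_frobNorm_mul_of_specNorm_sub_one_le hδ hA₁ (A⁻¹ * (Φ * Ul)ᵀ * (Φ * Uk))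
  rw [hB] at hX
  have hF := frobNorm_le_sqrt_card_mul_specNorm (Ulᵀ * (Φᵀ * Φ - 1) * Uk)
  rw [Fintype.card_fin] at hF
  have hadd := frobNorm_add_le (Ukᵀ * Ul)ᵀ (Ulᵀ * (Φᵀ * Φ - 1) * Uk)
  rw [frobNorm_transpose] at hadd
  have hF' := hF.trans (mul_le_mul_of_nonneg_left h2 (Real.sqrt_nonneg _))
  have hδ₀ : 0 ≤ δ := (specNorm_nonneg _).trans h2
  have hδ₁ : 0 < 1 - δ := sub_pos.2 hδ
  rw [min_eq_left (Nat.cast_le.2 hdkdl), one_div_mul_eq_div, le_div_iff₀' hδ₁]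
  rcases (Real.sqrt_nonneg (dk : ℝ)).eq_or_lt with h₀ | h₀
  · simpa [← h₀] using hδ₀
  · rw [← mul_div_assoc, div_add' _ _ _ h₀.ne']
    gcongr
    linarith
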